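/- For each natural number k, let ψ_k : ℚ[v₁, …, v₇] → ℚ[x₁, x₂] be the ℚ-algebra homomorphism determined by ψ_k(v₁) = 0, ψ_k(v₂) = 0, ψ_k(v₃) = 8k²x₁² − 8kx₁x₂ + 4x₁² + 4x₂², ψ_k(v₄) = 32k⁴x₁⁴ − 64k³x₁³x₂ + 16k²x₁⁴ + 48k²x₁²x₂² − 16kx₁³x₂ − 16kx₁x₂³ + 4x₁⁴ + 8x₁²x₂² + 4x₂⁴, ψ_k(v₅) = 8k²x₁⁴ − 8kx₁³x₂ + 4x₁²x₂², ψ_k(v₆) = 32k⁴x₁⁶ − 64k³x₁⁵x₂ + 8k²x₁⁶ + 48k²x₁⁴x₂² − 8kx₁⁵x₂ − 16kx₁³x₂³ + 4x₁⁴x₂² + 4x₁²x₂⁴, and ψ_k(v₇) = 32k⁴x₁⁸ − 64k³x₁⁷x₂ + 48k²x₁⁶x₂² − 16kx₁⁵x₂³ + 4x₁⁴x₂⁴. Then for every k the quotient ring ℚ[v₁, …, v₇]/ker(ψ_k) has Krull dimension 2. -/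

import Mathlib

open MvPolynomial

set_option synthInstance.maxHeartbeats 1000000
set_option maxHeartbeats 1000000

/-- The ℚ-algebra map `ψ_k : ℚ[v₁,…,v₇] → ℚ[x₁,x₂]` (with `x₁ = X 0`, `x₂ = X 1`)
coming from equivariant localisation for the `k`-th torus action on `S² × S²`. -/
noncomputable def psi (k : ℕ) : MvPolynomial (Fin 7) ℚ →ₐ[ℚ] MvPolynomial (Fin 2) ℚ :=
  MvPolynomial.aeval
    ![0, 0,
      8 * (k : MvPolynomial (Fin 2) ℚ) ^ 2 * X 0 ^ 2
        - 8 * (k : MvPolynomial (Fin 2) ℚ) * X 0 * X 1 + 4 * X 0 ^ 2 + 4 * X 1 ^ 2,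
      32 * (k : MvPolynomial (Fin 2) ℚ) ^ 4 * X 0 ^ 4
        - 64 * (k : MvPolynomial (Fin 2) ℚ) ^ 3 * X 0 ^ 3 * X 1
        + 16 * (k : MvPolynomial (Fin 2) ℚ) ^ 2 * X 0 ^ 4
        + 48 * (k : MvPolynomial (Fin 2) ℚ) ^ 2 * X 0 ^ 2 * X 1 ^ 2
        - 16 * (k : MvPolynomial (Fin 2) ℚ) * X 0 ^ 3 * X 1
        - 16 * (k : MvPolynomial (Fin 2) ℚ) * X 0 * X 1 ^ 3
        + 4 * X 0 ^ 4 + 8 * X 0 ^ 2 * X 1 ^ 2 + 4 * X 1 ^ 4,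
      8 * (k : MvPolynomial (Fin 2) ℚ) ^ 2 * X 0 ^ 4
        - 8 * (k : MvPolynomial (Fin 2) ℚ) * X 0 ^ 3 * X 1 + 4 * X 0 ^ 2 * X 1 ^ 2,
      32 * (k : MvPolynomial (Fin 2) ℚ) ^ 4 * X 0 ^ 6
        - 64 * (k : MvPolynomial (Fin 2) ℚ) ^ 3 * X 0 ^ 5 * X 1
        + 8 * (k : MvPolynomial (Fin 2) ℚ) ^ 2 * X 0 ^ 6
        + 48 * (k : MvPolynomial (Fin 2) ℚ) ^ 2 * X 0 ^ 4 * X 1 ^ 2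
        - 8 * (k : MvPolynomial (Fin 2) ℚ) * X 0 ^ 5 * X 1
        - 16 * (k : MvPolynomial (Fin 2) ℚ) * X 0 ^ 3 * X 1 ^ 3
        + 4 * X 0 ^ 4 * X 1 ^ 2 + 4 * X 0 ^ 2 * X 1 ^ 4,
      32 * (k : MvPolynomial (Fin 2) ℚ) ^ 4 * X 0 ^ 8
        - 64 * (k : MvPolynomial (Fin 2) ℚ) ^ 3 * X 0 ^ 7 * X 1
        + 48 * (k : MvPolynomial (Fin 2) ℚ) ^ 2 * X 0 ^ 6 * X 1 ^ 2
        - 16 * (k : MvPolynomial (Fin 2) ℚ) * X 0 ^ 5 * X 1 ^ 3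
        + 4 * X 0 ^ 4 * X 1 ^ 4]

theorem ringKrullDim_eq_of_integral_injective {R S : Type*} [CommRing R] [CommRing S] [Algebra R S]
    [Algebra.IsIntegral R S] (hinj : Function.Injective (algebraMap R S)) :
    ringKrullDim R = ringKrullDim S := by
  apply le_antisymm
  · refine iSup_le fun l => ?_
    obtain ⟨Q, -, hQ, hQ'⟩ := Ideal.exists_ideal_over_prime_of_isIntegral (S := S)
      (RelSeries.head l).asIdeal ⊥
      (by rw [← RingHom.ker_eq_comap_bot, (RingHom.injective_iff_ker_eq_bot _).1 hinj]
          exact bot_le)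
    have : Q.LiesOver (RelSeries.head l).asIdeal := ⟨hQ'.symm⟩
    obtain ⟨L, hL, -⟩ := Ideal.exists_ltSeries_of_hasGoingUp l Q
    rw [← hL]
    exact Order.LTSeries.length_le_krullDim L
  · exact Order.krullDim_le_of_strictMono (PrimeSpectrum.comap (algebraMap R S))
      fun I J h => Ideal.IsIntegral.comap_lt_comap (R := R) (I := I.asIdeal) (J := J.asIdeal) h

theorem psi_isIntegral (k : ℕ) (p : MvPolynomial (Fin 2) ℚ) :
    (psi k : MvPolynomial (Fin 7) ℚ →+* MvPolynomial (Fin 2) ℚ).IsIntegralElem p := by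
  let f : MvPolynomial (Fin 7) ℚ →+* MvPolynomial (Fin 2) ℚ := psi k
  let _ := f.toAlgebra
  change IsIntegral (MvPolynomial (Fin 7) ℚ) p
  have e3 : algebraMap (MvPolynomial (Fin 7) ℚ) (MvPolynomial (Fin 2) ℚ) (X 2)
      = 8 * (k : MvPolynomial (Fin 2) ℚ) ^ 2 * X 0 ^ 2
        - 8 * (k : MvPolynomial (Fin 2) ℚ) * X 0 * X 1 + 4 * X 0 ^ 2 + 4 * X 1 ^ 2 := by
    change psi k (X 2) = _
    simp [psi]
  have e5 : algebraMap (MvPolynomial (Fin 7) ℚ) (MvPolynomial (Fin 2) ℚ) (X 4)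
      = 8 * (k : MvPolynomial (Fin 2) ℚ) ^ 2 * X 0 ^ 4
        - 8 * (k : MvPolynomial (Fin 2) ℚ) * X 0 ^ 3 * X 1 + 4 * X 0 ^ 2 * X 1 ^ 2 := by
    change psi k (X 4) = _
    simp [psi]
  have eC (c : ℚ) : algebraMap (MvPolynomial (Fin 7) ℚ) (MvPolynomial (Fin 2) ℚ) (C c) = C c := by
    change psi k (C c) = _
    simp [psi, MvPolynomial.algebraMap_eq]
  have h4 : (C (1 / 4 : ℚ) : MvPolynomial (Fin 2) ℚ) * 4 = 1 := by
    rw [show (4 : MvPolynomial (Fin 2) ℚ) = C 4 from (map_ofNat C 4).symm, ← C_mul]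
    norm_num
  have hA : IsIntegral (MvPolynomial (Fin 7) ℚ) (X 0 : MvPolynomial (Fin 2) ℚ) := by
    refine ⟨Polynomial.X ^ 4 - Polynomial.C (C (1 / 4) * X 2) * Polynomial.X ^ 2
      + Polynomial.C (C (1 / 4) * X 4), by monicity!, ?_⟩
    simp only [Polynomial.eval₂_add, Polynomial.eval₂_sub, Polynomial.eval₂_mul,
      Polynomial.eval₂_pow, Polynomial.eval₂_X, Polynomial.eval₂_C, map_mul, e3, e5, eC]
    linear_combination (-X 0 ^ 4) * h4
  have hB : IsIntegral (MvPolynomial (Fin 7) ℚ) (X 1 : MvPolynomial (Fin 2) ℚ) := by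
    have hk : IsIntegral (MvPolynomial (Fin 7) ℚ) (k : MvPolynomial (Fin 2) ℚ) := by
      simpa using isIntegral_algebraMap (R := MvPolynomial (Fin 7) ℚ)
        (A := MvPolynomial (Fin 2) ℚ) (x := (k : MvPolynomial (Fin 7) ℚ))
    have hsq : IsIntegral (MvPolynomial (Fin 7) ℚ)
        ((X 1 - (k : MvPolynomial (Fin 2) ℚ) * X 0 : MvPolynomial (Fin 2) ℚ) ^ 2) := by
      have : ((X 1 - (k : MvPolynomial (Fin 2) ℚ) * X 0 : MvPolynomial (Fin 2) ℚ) ^ 2)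
          = algebraMap (MvPolynomial (Fin 7) ℚ) (MvPolynomial (Fin 2) ℚ) (C (1 / 4) * X 2)
            - X 0 ^ 2 - (k : MvPolynomial (Fin 2) ℚ) ^ 2 * X 0 ^ 2 := by
        rw [map_mul, eC, e3]
        linear_combination (-(2 * (k : MvPolynomial (Fin 2) ℚ) ^ 2 * X 0 ^ 2
          - 2 * (k : MvPolynomial (Fin 2) ℚ) * X 0 * X 1 + X 0 ^ 2 + X 1 ^ 2)) * h4
      rw [this]
      exact (isIntegral_algebraMap.sub (hA.pow 2)).sub ((hk.pow 2).mul (hA.pow 2))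
    have := (IsIntegral.of_pow (by norm_num) hsq).add (hk.mul hA)
    simpa using this
  induction p using MvPolynomial.induction_on with
  | C a => rw [← eC]; exact isIntegral_algebraMap
  | add p q hp hq => exact hp.add hq
  | mul_X p i hp =>
    refine hp.mul ?_
    fin_cases i
    · exact hA
    · exact hB

/-- For every `k`, the quotient `ℚ[v₁,…,v₇]/ker(ψ_k)` has Krull dimension 2. -/
theorem S2S2_single_torus_action_dim_two (k : ℕ) :
    ringKrullDim (MvPolynomial (Fin 7) ℚ ⧸ RingHom.ker (psi k)) = 2 := by
  let g : (MvPolynomial (Fin 7) ℚ ⧸ RingHom.ker (psi k)) →+* MvPolynomial (Fin 2) ℚ :=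
    RingHom.kerLift (psi k : MvPolynomial (Fin 7) ℚ →+* MvPolynomial (Fin 2) ℚ)
  have hg : Function.Injective g := RingHom.kerLift_injective _
  let _ := g.toAlgebra
  have hint : g.IsIntegral := by
    refine RingHom.IsIntegral.tower_top (Ideal.Quotient.mk (RingHom.ker (psi k))) g ?_
    intro p
    exact psi_isIntegral k p
  have : Algebra.IsIntegral (MvPolynomial (Fin 7) ℚ ⧸ RingHom.ker (psi k))
    (MvPolynomial (Fin 2) ℚ) := ⟨hint⟩
  rw [ringKrullDim_eq_of_integral_injective (S := MvPolynomial (Fin 2) ℚ) hg]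
  simp
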